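/- Let P, Q ∈ GL⁺(H), let (Λ_w)_{w∈Ω} satisfy ∫_Ω ‖Λ_w P f‖² dμ(w) ≤ B_Λ‖f‖² for all f ∈ H and (Γ_w)_{w∈Ω} satisfy ∫_Ω ‖Γ_w Q f‖² dμ(w) ≤ B_Γ‖f‖² for all f ∈ H. Then the following are equivalent: (1) ⟨f, g⟩ = ∫_Ω ⟨Γ_w Q f, Λ_w P g⟩ dμ(w) for all f, g ∈ H; (2) ⟨f, g⟩ = ∫_Ω ⟨Λ_w P f, Γ_w Q g⟩ dμ(w) for all f, g ∈ H; (3) ‖f‖² = ∫_Ω ⟨Λ_w P f, Γ_w Q f⟩ dμ(w) for all f ∈ H. -/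

import Mathlib

open MeasureTheory
open scoped ComplexInnerProductSpace

theorem MeasureTheory.MemLp.integrable_inner_of_two {L Ω : Type*} [NormedAddCommGroup L]
    [InnerProductSpace ℂ L] [MeasurableSpace Ω] {μ : Measure Ω} {u v : Ω → L}
    (hu : MemLp u 2 μ) (hv : MemLp v 2 μ) :
    Integrable (fun w => (⟪u w, v w⟫ : ℂ)) μ := by
  refine (hu.norm.integrable_mul hv.norm).mono'
    (hu.aestronglyMeasurable.inner hv.aestronglyMeasurable) ?_
  exact Filter.Eventually.of_forall fun w => norm_inner_le_norm _ _

/-- A complex sesquilinear form that vanishes on the diagonal is zero. -/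
theorem LinearMap.apply_eq_zero_of_forall_self {H : Type*} [AddCommGroup H] [Module ℂ H]
    (S : H →ₗ⋆[ℂ] H →ₗ[ℂ] ℂ) (hS : ∀ f, S f f = 0) (f g : H) : S f g = 0 := by
  have h₁ := hS (f + g)
  have h₂ := hS (f + Complex.I • g)
  simp only [map_add, LinearMap.add_apply, map_smul, LinearMap.map_smulₛₗ, LinearMap.smul_apply,
    smul_eq_mul, Complex.conj_I, hS, mul_zero, zero_add, add_zero] at h₁ h₂
  have h₃ : 2 * Complex.I * S f g = 0 := by linear_combination h₂ + Complex.I * h₁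
  simpa using h₃

/-- The sesquilinear form `⟨f, g⟩ ↦ ∫ ⟪A w f, B w g⟫` of two families of operators
with square-integrable orbits. -/
noncomputable def integralInnerForm {H L Ω : Type*} [NormedAddCommGroup H] [InnerProductSpace ℂ H]
    [NormedAddCommGroup L] [InnerProductSpace ℂ L] [MeasurableSpace Ω] (μ : Measure Ω)
    (A B : Ω → H →L[ℂ] L) (hA : ∀ f, MemLp (fun w => A w f) 2 μ)
    (hB : ∀ f, MemLp (fun w => B w f) 2 μ) : H →ₗ⋆[ℂ] H →ₗ[ℂ] ℂ :=
  LinearMap.mk₂'ₛₗ (starRingEnd ℂ) (RingHom.id ℂ) (fun f g => ∫ w, ⟪A w f, B w g⟫ ∂μ)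
    (fun f₁ f₂ g => by
      simp only [map_add, inner_add_left]
      exact integral_add ((hA f₁).integrable_inner_of_two (hB g))
        ((hA f₂).integrable_inner_of_two (hB g)))
    (fun c f g => by
      simp only [map_smul, inner_smul_left, smul_eq_mul]
      exact integral_const_mul _ _)
    (fun f g₁ g₂ => by
      simp only [map_add, inner_add_right]
      exact integral_add ((hA f).integrable_inner_of_two (hB g₁))
        ((hA f).integrable_inner_of_two (hB g₂)))
    (fun c f g => by
      simp only [map_smul, inner_smul_right, RingHom.id_apply, smul_eq_mul]
      exact integral_const_mul _ _)

/-- Equivalence of the three formulations of the controlled duality relation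
between `(Λ_w)` and `(Γ_w)`. -/
theorem controlled_duality_tfae
    {H L Ω : Type*}
    [NormedAddCommGroup H] [InnerProductSpace ℂ H] [CompleteSpace H]
    [NormedAddCommGroup L] [InnerProductSpace ℂ L] [CompleteSpace L]
    [MeasurableSpace Ω] (μ : Measure Ω)
    (Λ Γ : Ω → H →L[ℂ] L)
    (hΛmeas : ∀ f : H, AEStronglyMeasurable (fun w => Λ w f) μ)
    (hΛint : ∀ f : H, Integrable (fun w => ‖Λ w f‖ ^ 2) μ)
    (hΓmeas : ∀ f : H, AEStronglyMeasurable (fun w => Γ w f) μ)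
    (hΓint : ∀ f : H, Integrable (fun w => ‖Γ w f‖ ^ 2) μ)
    -- P, Q ∈ GL⁺(H)
    (P Q Pinv Qinv : H →L[ℂ] H)
    (hP : P.IsPositive) (hPinv : P * Pinv = 1 ∧ Pinv * P = 1)
    (hQ : Q.IsPositive) (hQinv : Q * Qinv = 1 ∧ Qinv * Q = 1)
    -- controlled Bessel bounds
    (BΛ BΓ : ℝ) (hBΛ : 0 < BΛ) (hBΓ : 0 < BΓ)
    (hΛBessel : ∀ f : H, ∫ w, ‖Λ w (P f)‖ ^ 2 ∂μ ≤ BΛ * ‖f‖ ^ 2)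
    (hΓBessel : ∀ f : H, ∫ w, ‖Γ w (Q f)‖ ^ 2 ∂μ ≤ BΓ * ‖f‖ ^ 2) :
    ((∀ f g : H, (⟪f, g⟫ : ℂ) = ∫ w, ⟪Γ w (Q f), Λ w (P g)⟫ ∂μ) ↔
      (∀ f g : H, (⟪f, g⟫ : ℂ) = ∫ w, ⟪Λ w (P f), Γ w (Q g)⟫ ∂μ)) ∧
    ((∀ f g : H, (⟪f, g⟫ : ℂ) = ∫ w, ⟪Λ w (P f), Γ w (Q g)⟫ ∂μ) ↔
      (∀ f : H, ((‖f‖ ^ 2 : ℝ) : ℂ) = ∫ w, ⟪Λ w (P f), Γ w (Q f)⟫ ∂μ)) := by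
  have inner_symm (A B : Ω → H →L[ℂ] L) (h : ∀ f g : H, (⟪f, g⟫ : ℂ) = ∫ w, ⟪A w f, B w g⟫ ∂μ)
      (f g : H) : (⟪f, g⟫ : ℂ) = ∫ w, ⟪B w f, A w g⟫ ∂μ := by
    rw [← inner_conj_symm, h g f, ← integral_conj]
    simp only [inner_conj_symm]
  refine ⟨⟨inner_symm (fun w => Γ w ∘L Q) (fun w => Λ w ∘L P),
    inner_symm (fun w => Λ w ∘L P) (fun w => Γ w ∘L Q)⟩, fun h f => ?_, fun h f g => ?_⟩
  · rw [← h f f, inner_self_eq_norm_sq_to_K]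
    push_cast
    rfl
  · have hA (f : H) : MemLp (fun w => (Λ w ∘L P) f) 2 μ :=
      (memLp_two_iff_integrable_sq_norm (hΛmeas (P f))).2 (hΛint (P f))
    have hB (f : H) : MemLp (fun w => (Γ w ∘L Q) f) 2 μ :=
      (memLp_two_iff_integrable_sq_norm (hΓmeas (Q f))).2 (hΓint (Q f))
    refine sub_eq_zero.1 <| LinearMap.apply_eq_zero_of_forall_self
      (innerₛₗ ℂ - integralInnerForm μ _ _ hA hB) (fun f => ?_) f g
    refine sub_eq_zero.2 (Eq.trans ?_ (h f))
    rw [innerₛₗ_apply_apply, inner_self_eq_norm_sq_to_K]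
    push_cast
    rfl
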